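/- Let F be a free group and let p be a primitive element of F. If q ∈ F is an element whose normal closure contains p and whose normal closure equals the normal closure of p, then q is conjugate to p or to p⁻¹. -/

import Mathlib

/-- An element of a free group is primitive if it belongs to some basis. -/
def FreeGroup.IsPrimitive {α : Type*} (g : FreeGroup α) : Prop :=
  ∃ S : Set (FreeGroup α), Nonempty (FreeGroupBasis S (FreeGroup α)) ∧ g ∈ S

namespace FreeGroup

universe u

/-- The endomorphism of a free group that kills the generators in `S`. -/
noncomputable def erase {X : Type*} (S : Set X) : FreeGroup X →* FreeGroup X :=
  open Classical in lift fun x => if x ∈ S then 1 else of x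

theorem erase_of_mem {X : Type*} {S : Set X} {x : X} (h : x ∈ S) : erase S (of x) = 1 := by
  simp [erase, h]

theorem erase_of_notMem {X : Type*} {S : Set X} {x : X} (h : x ∉ S) :
    erase S (of x) = of x := by
  simp [erase, h]

theorem mk_cons_true {X : Type*} (x : X) (w : List (X × Bool)) :
    mk ((x, true) :: w) = of x * mk w := by
  simp [of]

theorem mk_cons_false {X : Type*} (x : X) (w : List (X × Bool)) :
    mk ((x, false) :: w) = (of x)⁻¹ * mk w := by
  simp [of, invRev]

theorem map_mk_congr {X M : Type*} [Group M] (f g : FreeGroup X →* M) (w : List (X × Bool))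
    (h : ∀ a ∈ w, f (of a.1) = g (of a.1)) : f (mk w) = g (mk w) := by
  induction w with
  | nil => simp [← one_eq_mk]
  | cons a w ih =>
    have h₁ := h a (by simp)
    have h₂ := ih fun b hb => h b (by simp [hb])
    obtain ⟨x, _ | _⟩ := a
    · simp_all [mk_cons_false]
    · simp_all [mk_cons_true]

theorem exists_mk_eq_erase {X : Type*} (S : Set X) (w : List (X × Bool)) :
    ∃ w', mk w' = erase S (mk w) ∧ w'.length ≤ w.length ∧
      ((∃ a ∈ w, a.1 ∈ S) → w'.length < w.length) := by
  induction w with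
  | nil => exact ⟨[], by simp [← one_eq_mk]⟩
  | cons a w ih =>
    obtain ⟨w', h, hle, hlt⟩ := ih
    by_cases ha : a.1 ∈ S
    · refine ⟨w', ?_, by simp; lia, fun _ => by simp; lia⟩
      obtain ⟨x, _ | _⟩ := a
      · simp_all [mk_cons_false, erase_of_mem ha]
      · simp_all [mk_cons_true, erase_of_mem ha]
    · refine ⟨a :: w', ?_, by simpa, ?_⟩
      · obtain ⟨x, _ | _⟩ := a
        · simp_all [mk_cons_false, erase_of_notMem ha]
        · simp_all [mk_cons_true, erase_of_notMem ha]
      · rintro ⟨b, hb, hbS⟩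
        obtain rfl | hb := List.mem_cons.1 hb
        · exact absurd hbS ha
        · simpa using hlt ⟨b, hb, hbS⟩

/-- A word that is shortest among all words representing a conjugate of the same element. -/
def IsMinimalWord {X : Type*} (w : List (X × Bool)) : Prop :=
  ∀ w', IsConj (mk w) (mk w') → w.length ≤ w'.length

theorem exists_isMinimalWord {X : Type*} (w₀ : List (X × Bool)) :
    ∃ w, IsConj (mk w₀) (mk w) ∧ IsMinimalWord w ∧ w.length ≤ w₀.length := by
  classical
  have hex : ∃ n, ∃ w : List (X × Bool), IsConj (mk w₀) (mk w) ∧ w.length = n :=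
    ⟨_, w₀, IsConj.refl _, rfl⟩
  obtain ⟨w, hw, hlen⟩ := Nat.find_spec hex
  refine ⟨w, hw, fun w' hw' => ?_, ?_⟩
  · rw [hlen]
    exact Nat.find_min' hex ⟨w', hw.trans hw', rfl⟩
  · rw [hlen]
    exact Nat.find_min' hex ⟨w₀, IsConj.refl _, rfl⟩

theorem IsMinimalWord.notMem_of_erase_eq {X : Type*} {w : List (X × Bool)}
    (hw : IsMinimalWord w) {v : FreeGroup X} (hv : IsConj (mk w) v) {S : Set X}
    (hS : erase S v = v) {a : X × Bool} (ha : a ∈ w) : a.1 ∉ S := by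
  intro haS
  obtain ⟨w', hw', -, hlt⟩ := exists_mk_eq_erase S w
  have h := hw w' (hw' ▸ hv.trans (hS ▸ ((erase S).map_isConj hv).symm))
  have := hlt ⟨a, ha, haS⟩
  lia

theorem normalClosure_singleton_le_ker {G H : Type*} [Group G] [Group H] (f : G →* H) {q : G}
    (h : f q = 1) : Subgroup.normalClosure {q} ≤ f.ker :=
  Subgroup.normalClosure_le_normal (by simpa [MonoidHom.mem_ker] using h)

theorem normalClosure_singleton_eq_of_isConj {G : Type*} [Group G] {a b : G} (h : IsConj a b) :
    Subgroup.normalClosure {a} = Subgroup.normalClosure {b} := by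
  have key : ∀ {a b : G}, IsConj a b →
      Subgroup.normalClosure {b} ≤ Subgroup.normalClosure {a} := by
    intro a b h
    obtain ⟨c, rfl⟩ := isConj_iff.1 h
    refine Subgroup.normalClosure_le_normal ?_
    rw [Set.singleton_subset_iff]
    exact Subgroup.normalClosure_normal.conj_mem _
      (Subgroup.subset_normalClosure (Set.mem_singleton a)) c
  exact le_antisymm (key h.symm) (key h)

/-- The homomorphism sending the generator `(x, i)` to the conjugate of `x` by `t ^ i`. -/
def conjPow {X : Type*} (t : X) : FreeGroup (X × ℤ) →* FreeGroup X :=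
  lift fun e => of t ^ e.2 * of e.1 * (of t ^ e.2)⁻¹

/-- The endomorphism sending `t` to `t ^ s t` and every other generator `x` to `x * t ^ s x`. -/
noncomputable def twist {X : Type*} (t : X) (s : X → ℤ) : FreeGroup X →* FreeGroup X :=
  open Classical in lift fun x => if x = t then of t ^ s t else of x * of t ^ s x

/-- The weighted exponent sum. -/
def weight {X : Type*} (s : X → ℤ) : FreeGroup X →* Multiplicative ℤ :=
  lift fun x => Multiplicative.ofAdd (s x)

theorem conjPow_of {X : Type*} (t x : X) (i : ℤ) :
    conjPow t (of (x, i)) = of t ^ i * of x * (of t ^ i)⁻¹ := by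
  simp [conjPow]

theorem twist_of_self {X : Type*} (t : X) (s : X → ℤ) : twist t s (of t) = of t ^ s t := by
  simp [twist]

theorem twist_of_ne {X : Type*} {t x : X} (s : X → ℤ) (h : x ≠ t) :
    twist t s (of x) = of x * of t ^ s x := by
  simp [twist, h]

theorem weight_of {X : Type*} (s : X → ℤ) (x : X) :
    weight s (of x) = Multiplicative.ofAdd (s x) := by
  simp [weight]

/-- The combination of the exponent sums of `y` and `t` that vanishes on `g`. -/
theorem weight_single_sub_single_self {X : Type*} [DecidableEq X] {y t : X} (hyt : y ≠ t)
    (g : FreeGroup X) :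
    weight (Pi.single t (weight (Pi.single y 1) g).toAdd -
      Pi.single y (weight (Pi.single t 1) g).toAdd) g = 1 := by
  have h : ∀ σ β : ℤ, weight (Pi.single t σ - Pi.single y β) =
      weight (Pi.single t 1) ^ σ * weight (Pi.single y 1) ^ (-β) := by
    intro σ β
    ext x
    apply Multiplicative.toAdd.injective
    by_cases h₁ : x = t
    · subst h₁; simp [weight_of, hyt.symm]
    · by_cases h₂ : x = y
      · subst h₂; simp [weight_of, h₁]
      · simp [weight_of, h₁, h₂]
  rw [h]
  apply Multiplicative.toAdd.injective
  simp [mul_comm]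

theorem twist_single {X : Type*} [DecidableEq X] (t : X) :
    twist t (Pi.single t 1) = MonoidHom.id (FreeGroup X) := by
  ext x
  by_cases h : x = t
  · subst h; simp [twist_of_self]
  · simp [twist_of_ne _ h, h]

theorem exists_conjPow_word {X : Type*} (t : X) (s : X → ℤ) (w : List (X × Bool)) (k : ℤ) :
    ∃ w' : List ((X × ℤ) × Bool), w'.length ≤ w.length ∧
      ((∃ a ∈ w, a.1 = t) → w'.length < w.length) ∧ (∀ a ∈ w', a.1.1 ≠ t) ∧
      of t ^ k * twist t s (mk w) =
        conjPow t (mk w') * of t ^ (k + (weight s (mk w)).toAdd) := by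
  induction w generalizing k with
  | nil => exact ⟨[], by simp [← one_eq_mk]⟩
  | cons a w ih =>
    obtain ⟨x, b⟩ := a
    by_cases hx : x = t
    · subst hx
      cases b
      · obtain ⟨w', hle, -, ht, h⟩ := ih (k - s x)
        refine ⟨w', by simp; lia, fun _ => by simp; lia, ht, ?_⟩
        rw [mk_cons_false, _root_.map_mul, _root_.map_mul, _root_.map_inv, _root_.map_inv,
          twist_of_self, weight_of, ← mul_assoc, ← zpow_neg, ← zpow_add, ← sub_eq_add_neg, h]
        simp [sub_eq_add_neg, add_assoc]
      · obtain ⟨w', hle, -, ht, h⟩ := ih (k + s x)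
        refine ⟨w', by simp; lia, fun _ => by simp; lia, ht, ?_⟩
        rw [mk_cons_true, _root_.map_mul, _root_.map_mul, twist_of_self, weight_of,
          ← mul_assoc, ← zpow_add, h]
        simp [add_assoc]
    · cases b
      · obtain ⟨w', hle, hlt, ht, h⟩ := ih (k - s x)
        refine ⟨((x, k - s x), false) :: w', by simpa, by simpa [hx] using hlt,
          by simpa [hx] using ht, ?_⟩
        rw [mk_cons_false, mk_cons_false, _root_.map_mul, _root_.map_mul, _root_.map_mul,
          _root_.map_inv, _root_.map_inv, _root_.map_inv, twist_of_ne _ hx, weight_of, conjPow_of]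
        have := eq_inv_mul_of_mul_eq h
        rw [this]
        simp only [toAdd_mul, toAdd_inv, toAdd_ofAdd]
        group
      · obtain ⟨w', hle, hlt, ht, h⟩ := ih (k + s x)
        refine ⟨((x, k), true) :: w', by simpa, by simpa [hx] using hlt,
          by simpa [hx] using ht, ?_⟩
        rw [mk_cons_true, mk_cons_true, _root_.map_mul, _root_.map_mul, _root_.map_mul,
          twist_of_ne _ hx, weight_of, conjPow_of]
        have := eq_inv_mul_of_mul_eq h
        rw [this]
        simp only [toAdd_mul, toAdd_ofAdd]
        group

theorem map_val_injective_of_erase {X : Type*} {r : FreeGroup X} {e : X}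
    (he : ∀ g, erase {e} g = g → g ∈ Subgroup.normalClosure {r} → g = 1)
    {p : X → Prop} (hp : ¬ p e) :
    Function.Injective ((QuotientGroup.mk' (Subgroup.normalClosure {r})).comp
      (map (Subtype.val : {x // p x} → X))) := by
  rw [injective_iff_map_eq_one]
  intro g hg
  have hfix : (erase {e}).comp (map (Subtype.val : {x // p x} → X)) = map Subtype.val := by
    ext x
    have : x.1 ∉ ({e} : Set X) := by
      rintro rfl
      exact hp x.2
    simp [erase_of_notMem this]
  have h := he (map Subtype.val g) (DFunLike.congr_fun hfix g)
    ((QuotientGroup.eq_one_iff _).1 hg)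
  exact map_injective Subtype.val_injective (h.trans (_root_.map_one _).symm)

theorem exists_shift_extension {X : Type u} (r : FreeGroup (X × ℤ)) (z : X) (m M : ℤ)
    (hm : ∀ g, erase {(z, m)} g = g → g ∈ Subgroup.normalClosure {r} → g = 1)
    (hM : ∀ g, erase {(z, M)} g = g → g ∈ Subgroup.normalClosure {r} → g = 1) :
    ∃ (G : Type u) (_ : Group G) (j : FreeGroup (X × ℤ) →* G) (T : G)
      (deg : G →* Multiplicative ℤ), j r = 1 ∧
      (∀ g, j g = 1 → g ∈ Subgroup.normalClosure {r}) ∧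
      deg T = Multiplicative.ofAdd 1 ∧ (∀ g, deg (j g) = 1) ∧
      ∀ x i, (x = z → m ≤ i ∧ i < M) → T * j (of (x, i)) * T⁻¹ = j (of (x, i + 1)) := by
  let pA : X × ℤ → Prop := fun e => e.1 = z → m ≤ e.2 ∧ e.2 < M
  let pB : X × ℤ → Prop := fun e => e.1 = z → m < e.2 ∧ e.2 ≤ M
  have hA := map_val_injective_of_erase (p := pA) hM (by simp [pA])
  have hB := map_val_injective_of_erase (p := pB) hm (by simp [pB])
  let e : {x // pA x} ≃ {x // pB x} :=
    { toFun := fun x => ⟨(x.1.1, x.1.2 + 1), fun h => by have := x.2 h; dsimp; lia⟩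
      invFun := fun x => ⟨(x.1.1, x.1.2 - 1), fun h => by have := x.2 h; dsimp; lia⟩
      left_inv := fun x => by simp
      right_inv := fun x => by simp }
  let φ := ((MonoidHom.ofInjective hA).symm.trans (freeGroupCongr e)).trans
    (MonoidHom.ofInjective hB)
  let π := QuotientGroup.mk' (Subgroup.normalClosure {r})
  refine ⟨HNNExtension _ _ _ φ, inferInstance, HNNExtension.of.comp π,
    HNNExtension.t, HNNExtension.lift 1 (Multiplicative.ofAdd 1) (by simp), ?_, ?_, ?_, ?_, ?_⟩
  · have : π r = 1 := (QuotientGroup.eq_one_iff _).2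
      (Subgroup.subset_normalClosure (Set.mem_singleton r))
    simp [this]
  · intro g hg
    exact (QuotientGroup.eq_one_iff _).1
      (HNNExtension.of_injective (φ := φ) (hg.trans (_root_.map_one _).symm))
  · simp
  · simp
  · intro x i h
    let a : {x // pA x} := ⟨(x, i), h⟩
    have ha := HNNExtension.equiv_eq_conj (φ := φ) (MonoidHom.ofInjective hA (of a))
    have h₁ : φ (MonoidHom.ofInjective hA (of a)) = MonoidHom.ofInjective hB (of (e a)) := by
      simp only [φ, MulEquiv.trans_apply, MulEquiv.symm_apply_apply]
      congr 1
    rw [h₁] at ha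
    exact ha.symm

theorem conj_zpow_eq_of_shift {G : Type*} [Group G] {T : G} {f : ℤ → G}
    (h : ∀ i, T * f i * T⁻¹ = f (i + 1)) (i : ℤ) : T ^ i * f 0 * (T ^ i)⁻¹ = f i := by
  induction i with
  | zero => simp
  | succ k ih => rw [← h, ← ih]; group
  | pred k ih =>
    have := h (-(k : ℤ) - 1)
    rw [sub_add_cancel, ← ih] at this
    have h₂ : f (-(k : ℤ) - 1) = T⁻¹ * (T * f (-(k : ℤ) - 1) * T⁻¹) * T := by group
    rw [h₂, this]; group

theorem conj_pow_eq_of_shift {G : Type*} [Group G] {T : G} {f : ℤ → G} {m M : ℤ}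
    (h : ∀ i, m ≤ i ∧ i < M → T * f i * T⁻¹ = f (i + 1)) (k : ℕ) (hk : m + k ≤ M) :
    T ^ k * f m * (T ^ k)⁻¹ = f (m + k) := by
  induction k with
  | zero => simp
  | succ k ih =>
    push_cast at hk ⊢
    rw [← add_assoc, ← h _ (by lia), ← ih (by lia)]; group

theorem exists_conjPow_extension {X : Type u} (t : X) (r : FreeGroup (X × ℤ)) (z : X) (m M : ℤ)
    (hm : ∀ g, erase {(z, m)} g = g → g ∈ Subgroup.normalClosure {r} → g = 1)
    (hM : ∀ g, erase {(z, M)} g = g → g ∈ Subgroup.normalClosure {r} → g = 1) :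
    ∃ (G : Type u) (_ : Group G) (j : FreeGroup (X × ℤ) →* G) (Φ : FreeGroup X →* G)
      (deg : G →* Multiplicative ℤ), j r = 1 ∧
      (∀ g, j g = 1 → g ∈ Subgroup.normalClosure {r}) ∧
      deg (Φ (of t)) = Multiplicative.ofAdd 1 ∧ (∀ x ≠ t, deg (Φ (of x)) = 1) ∧
      ∀ x i, x ≠ t → (x = z → m ≤ i ∧ i ≤ M) → Φ (conjPow t (of (x, i))) = j (of (x, i)) := by
  classical
  obtain ⟨G, _, j, T, deg, hr, hj, hT, hdeg, hshift⟩ := exists_shift_extension r z m M hm hM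
  let Φ : FreeGroup X →* G := lift fun x => if x = t then T else
    if x = z then (T ^ m)⁻¹ * j (of (z, m)) * T ^ m else j (of (x, 0))
  have hΦt : Φ (of t) = T := by simp [Φ]
  refine ⟨G, inferInstance, j, Φ, deg, hr, hj, by rw [hΦt, hT], ?_, ?_⟩
  · intro x hx
    by_cases hz : x = z <;> simp_all [Φ]
  · intro x i hx hi
    rw [conjPow_of, _root_.map_mul, _root_.map_mul, _root_.map_inv, map_zpow, hΦt]
    by_cases hz : x = z
    · subst hz
      obtain ⟨h₁, h₂⟩ := hi rfl
      obtain ⟨k, rfl⟩ := Int.le.dest h₁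
      have := conj_pow_eq_of_shift (f := fun i => j (of (x, i)))
        (fun i hi => hshift x i fun _ => hi) k h₂
      rw [← this]
      simp only [Φ, lift_apply_of, hx, if_true, if_false]
      group
    · have := conj_zpow_eq_of_shift (f := fun i => j (of (x, i)))
        (fun i => hshift x i fun h => absurd h hz) i
      rw [← this]
      simp [Φ, hx, hz]

theorem exists_index_bounds {X : Type*} (r : List ((X × ℤ) × Bool)) {z : X}
    (h : ∃ b ∈ r, b.1.1 = z) :
    ∃ m M, (∃ b ∈ r, b.1 = (z, m)) ∧ (∃ b ∈ r, b.1 = (z, M)) ∧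
      ∀ b ∈ r, b.1.1 = z → m ≤ b.1.2 ∧ b.1.2 ≤ M := by
  classical
  let F := r.toFinset.filter fun b => b.1.1 = z
  have hF : F.Nonempty := by
    obtain ⟨b, hb, hz⟩ := h
    exact ⟨b, by simp [F, hb, hz]⟩
  obtain ⟨b, hb, hmin⟩ := F.exists_min_image (fun b => b.1.2) hF
  obtain ⟨c, hc, hmax⟩ := F.exists_max_image (fun b => b.1.2) hF
  simp only [F, Finset.mem_filter, List.mem_toFinset, and_imp] at hb hc hmin hmax
  exact ⟨b.1.2, c.1.2, ⟨b, hb.1, Prod.ext hb.2 rfl⟩, ⟨c, hc.1, Prod.ext hc.2 rfl⟩,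
    fun d hd hz => ⟨hmin d hd hz, hmax d hd hz⟩⟩

theorem erase_mk_eq_self {X : Type*} {S : Set X} {w : List (X × Bool)}
    (h : ∀ a ∈ w, a.1 ∉ S) : erase S (mk w) = mk w :=
  map_mk_congr (erase S) (MonoidHom.id _) w fun a ha => erase_of_notMem (h a ha)

theorem erase_mk_eq_one {X : Type*} {S : Set X} {w : List (X × Bool)}
    (h : ∀ a ∈ w, a.1 ∈ S) : erase S (mk w) = 1 :=
  map_mk_congr (erase S) 1 w fun a ha => erase_of_mem (h a ha)

/-- The instance of the Freiheitssatz for `w` obtained by omitting the generator `y`: no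
nontrivial element of the subgroup generated by the other generators lies in the normal closure
of `w`. -/
def FreeOmitting {X : Type*} (w : List (X × Bool)) (y : X) : Prop :=
  ∀ g, erase {y} g = g → g ∈ Subgroup.normalClosure {mk w} → g = 1

/-- A minimal word in the generators `(x, i)`, `x ≠ t`, representing up to conjugacy an
element of weight zero. -/
theorem exists_minimal_conjPow_word {X : Type*} (t : X) (s : X → ℤ) (w : List (X × Bool))
    (ht : ∃ a ∈ w, a.1 = t) (hs : weight s (mk w) = 1) :
    ∃ r : List ((X × ℤ) × Bool), IsMinimalWord r ∧ r.length < w.length ∧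
      (∀ b ∈ r, b.1.1 ≠ t) ∧ IsConj (twist t s (mk w)) (conjPow t (mk r)) := by
  obtain ⟨w₁, -, hlt, ht₁, h⟩ := exists_conjPow_word t s w 0
  obtain ⟨r, hr, hmin, hle⟩ := exists_isMinimalWord w₁
  refine ⟨r, hmin, hle.trans_lt (hlt ht), fun b hb => ?_, ?_⟩
  · exact hmin.notMem_of_erase_eq (S := {e | e.1 = t}) hr.symm (erase_mk_eq_self ht₁) hb
  · have h' : twist t s (mk w) = conjPow t (mk w₁) := by simpa [hs] using h
    rw [h']
    exact (conjPow t).map_isConj hr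

theorem freeOmitting_of_weight_eq_one {X : Type u} [DecidableEq X]
    {w : List (X × Bool)} (hw : IsMinimalWord w)
    {y : X} (hy : ∃ a ∈ w, a.1 = y)
    (hσ : weight (Pi.single y 1) (mk w) = 1)
    (ih : ∀ r : List ((X × ℤ) × Bool), IsMinimalWord r → r.length < w.length →
      ∀ b ∈ r, FreeOmitting r b.1) :
    FreeOmitting w y := by
  obtain ⟨r, hr, hlt, hry, hconj⟩ := exists_minimal_conjPow_word y (Pi.single y 1) w hy hσ
  rw [twist_single, MonoidHom.id_apply] at hconj
  have hfree := ih r hr hlt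
  obtain ⟨b₀, hb₀⟩ : ∃ b, b ∈ r := by
    obtain ⟨a, ha, -⟩ := hy
    cases r with
    | nil =>
      have := hw [] (by simpa [← one_eq_mk] using hconj)
      simp_all
    | cons b r => exact ⟨b, by simp⟩
  obtain ⟨m, M, ⟨bm, hbm, hm⟩, ⟨bM, hbM, hM⟩, hbd⟩ := exists_index_bounds r ⟨b₀, hb₀, rfl⟩
  have hex : ∃ b ∈ r, b.1.2 ≠ m := by
    by_contra! hall
    obtain ⟨a, ha, rfl⟩ := hy
    have h₁ : conjPow a.1 (mk r) = MulAut.conj (of a.1 ^ m) (map Prod.fst (mk r)) :=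
      map_mk_congr (conjPow a.1)
        ((MulAut.conj (of a.1 ^ m)).toMonoidHom.comp (map Prod.fst)) r fun b hb => by
          rw [← hall b hb, ← Prod.mk.eta (p := b.1), conjPow_of]; simp [-map_zpow]
    have h₂ : erase {a.1} (map Prod.fst (mk r)) = map Prod.fst (mk r) :=
      map_mk_congr ((erase {a.1}).comp (map Prod.fst)) (map Prod.fst) r fun b hb => by
        have : b.1.1 ∉ ({a.1} : Set X) := hry b hb
        simp [erase_of_notMem this]
    refine hw.notMem_of_erase_eq (hconj.trans ?_) h₂ ha rfl
    rw [h₁]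
    exact (isConj_iff.2 ⟨_, rfl⟩ : IsConj _ _).symm
  obtain ⟨b, hb, hbm'⟩ := hex
  obtain ⟨G, _, j, Φ, deg, hj₁, hj, -, -, hΦ⟩ := exists_conjPow_extension y (mk r) b₀.1.1 m M
    (hm ▸ hfree bm hbm) (hM ▸ hfree bM hbM)
  have hΦw : Φ (mk w) = 1 := by
    have h₁ : Φ (conjPow y (mk r)) = j (mk r) :=
      map_mk_congr (Φ.comp (conjPow y)) j r fun b hb => hΦ _ _ (hry b hb) (hbd b hb)
    rw [← isConj_one_left, ← hj₁, ← h₁]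
    exact Φ.map_isConj hconj
  intro g hg hgN
  have hΦg : Φ g = 1 := normalClosure_singleton_le_ker Φ hΦw hgN
  let ι : FreeGroup X →* FreeGroup (X × ℤ) := map fun x => (x, m)
  have hjι : j (ι g) = MulAut.conj (Φ (of y) ^ m) (Φ g) := by
    have : (j.comp ι).comp (erase {y}) =
        ((MulAut.conj (Φ (of y) ^ m)).toMonoidHom.comp Φ).comp (erase {y}) := by
      ext x
      by_cases hx : x ∈ ({y} : Set X)
      · simp [erase_of_mem hx]
      · have := hΦ x m hx fun h => ⟨le_rfl, (hbd b₀ hb₀ rfl).1.trans (hbd b₀ hb₀ rfl).2⟩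
        rw [conjPow_of] at this
        simp [erase_of_notMem hx, ι, ← this, -map_zpow, ← map_zpow Φ]
    simpa [hg] using DFunLike.congr_fun this g
  have hιg : ι g = 1 := by
    refine hfree b hb (ι g) ?_ (hj _ (by rw [hjι, hΦg, _root_.map_one]))
    have : (erase {b.1}).comp ι = ι := by
      ext x
      have : (x, m) ∉ ({b.1} : Set (X × ℤ)) := by
        rintro h
        exact hbm' (congrArg Prod.snd h.symm)
      simp [ι, erase_of_notMem this]
    exact DFunLike.congr_fun this g
  exact map_injective (fun x x' h => congrArg Prod.fst h) (hιg.trans (_root_.map_one _).symm)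

theorem freeOmitting_of_weight_ne_one {X : Type u} [DecidableEq X] {w : List (X × Bool)}
    {y t : X} (hyt : y ≠ t) (ht : ∃ a ∈ w, a.1 = t) {σ : ℤ} (hσ : σ ≠ 0)
    (hwσ : weight (Pi.single y 1) (mk w) = Multiplicative.ofAdd σ)
    (ih : ∀ r : List ((X × ℤ) × Bool), IsMinimalWord r → r.length < w.length →
      ∀ b ∈ r, FreeOmitting r b.1) :
    FreeOmitting w y := by
  let s : X → ℤ := Pi.single t σ - Pi.single y (weight (Pi.single t 1) (mk w)).toAdd
  have hst : s t = σ := by simp [s, hyt.symm]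
  have hsx : ∀ x, x ≠ t → x ≠ y → s x = 0 := fun x h₁ h₂ => by simp [s, h₁, h₂]
  have hs : weight s (mk w) = 1 := by
    simpa [hwσ] using weight_single_sub_single_self hyt (mk w)
  obtain ⟨r, hr, hlt, hrt, hconj⟩ := exists_minimal_conjPow_word t s w ht hs
  have hfree := ih r hr hlt
  have hex : ∃ b ∈ r, b.1.1 = y := by
    by_contra! hall
    have h₁ : weight (Pi.single y 1) (conjPow t (mk r)) = 1 :=
      map_mk_congr ((weight (Pi.single y 1)).comp (conjPow t)) 1 r fun b hb => by
        rw [← Prod.mk.eta (p := b.1), MonoidHom.comp_apply, conjPow_of]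
        simp [weight_of, hall b hb]
    have h₂ : (weight (Pi.single y 1)).comp (twist t s) = weight (Pi.single y 1) := by
      ext x
      by_cases h : x = t
      · subst h; simp [twist_of_self, weight_of, hyt.symm]
      · simp [twist_of_ne _ h, weight_of, hyt.symm]
    have h₃ := isConj_iff_eq.1 ((weight (Pi.single y 1)).map_isConj hconj)
    rw [h₁, ← MonoidHom.comp_apply, h₂, hwσ] at h₃
    exact hσ (Multiplicative.ofAdd.injective h₃)
  obtain ⟨m, M, ⟨bm, hbm, hm⟩, ⟨bM, hbM, hM⟩, hbd⟩ := exists_index_bounds r hex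
  obtain ⟨G, _, j, Φ, deg, hj₁, hj, hdt, hdx, hΦ⟩ := exists_conjPow_extension t (mk r) y m M
    (hm ▸ hfree bm hbm) (hM ▸ hfree bM hbM)
  have hΦw : Φ (twist t s (mk w)) = 1 := by
    have h₁ : Φ (conjPow t (mk r)) = j (mk r) :=
      map_mk_congr (Φ.comp (conjPow t)) j r fun b hb => hΦ _ _ (hrt b hb) (hbd b hb)
    rw [← isConj_one_left, ← hj₁, ← h₁]
    exact Φ.map_isConj hconj
  intro g hg hgN
  have hΦg : Φ (twist t s g) = 1 :=
    normalClosure_singleton_le_ker (Φ.comp (twist t s)) hΦw hgN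
  have hgt : weight (Pi.single t 1) g = 1 := by
    have : ((deg.comp Φ).comp (twist t s)).comp (erase {y}) =
        (weight (Pi.single t 1) ^ σ).comp (erase {y}) := by
      ext x
      by_cases hx : x ∈ ({y} : Set X)
      · simp [erase_of_mem hx]
      · by_cases h : x = t
        · subst h; simp [erase_of_notMem hx, twist_of_self, weight_of, hst, hdt]
        · simp [erase_of_notMem hx, twist_of_ne _ h, weight_of, hsx x h hx, hdx x h, h]
    have h := DFunLike.congr_fun this g
    simp only [MonoidHom.comp_apply, hg, hΦg, _root_.map_one, MonoidHom.zpow_apply] at h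
    have h' := congrArg Multiplicative.toAdd h
    apply Multiplicative.toAdd.injective
    simpa [hσ] using h'.symm
  obtain ⟨u, -, -, hut, hu⟩ := exists_conjPow_word t (Pi.single t 1) g.toWord 0
  simp only [mk_toWord, hgt, twist_single, toAdd_one, add_zero, zpow_zero, one_mul, mul_one,
    MonoidHom.id_apply] at hu
  let E : FreeGroup (X × ℤ) →* FreeGroup (X × ℤ) := erase {e | e.1 = y}
  have hE : conjPow t (E (mk u)) = g := by
    have : (conjPow t).comp E = (erase {y}).comp (conjPow t) := by
      ext ⟨x, i⟩
      have hty : t ∉ ({y} : Set X) := fun h => hyt h.symm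
      by_cases hx : x = y
      · have h₁ : (x, i) ∈ {e : X × ℤ | e.1 = y} := hx
        have h₂ : x ∈ ({y} : Set X) := hx
        simp [E, erase_of_mem h₁, erase_of_mem h₂, conjPow_of]
      · have h₁ : (x, i) ∉ {e : X × ℤ | e.1 = y} := hx
        have h₂ : x ∉ ({y} : Set X) := hx
        simp [E, erase_of_notMem h₁, erase_of_notMem h₂, erase_of_notMem hty, conjPow_of]
    rw [← MonoidHom.comp_apply, this, MonoidHom.comp_apply, ← hu, hg]
  let scale : FreeGroup (X × ℤ) →* FreeGroup (X × ℤ) := map fun e => (e.1, σ * e.2)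
  have hscale : Φ (twist t s (conjPow t (E (mk u)))) = j (scale (E (mk u))) :=
    map_mk_congr (((Φ.comp (twist t s)).comp (conjPow t)).comp E) ((j.comp scale).comp E) u
      fun b hb => by
        by_cases hx : b.1.1 = y
        · have h : b.1 ∈ {e : X × ℤ | e.1 = y} := hx
          simp [E, erase_of_mem h]
        · have h : b.1 ∉ {e : X × ℤ | e.1 = y} := hx
          have h' := hΦ b.1.1 (σ * b.1.2) (hut b hb) fun h => absurd h hx
          simp only [MonoidHom.comp_apply, E, erase_of_notMem h, scale, map.of, ← h']
          rw [← Prod.mk.eta (p := b.1), conjPow_of, conjPow_of]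
          simp [twist_of_self, twist_of_ne _ (hut b hb), hst, hsx _ (hut b hb) hx, zpow_mul]
  have hscale_one : scale (E (mk u)) = 1 := by
    refine hfree bm hbm _ ?_ (hj _ (by rw [← hscale, hE, hΦg]))
    have : ((erase {bm.1}).comp scale).comp E = scale.comp E := by
      ext e
      by_cases hx : e.1 = y
      · have h : e ∈ {e : X × ℤ | e.1 = y} := hx
        simp [E, erase_of_mem h]
      · have h : e ∉ {e : X × ℤ | e.1 = y} := hx
        have h' : (e.1, σ * e.2) ∉ ({bm.1} : Set (X × ℤ)) := by
          rw [hm]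
          exact fun h => hx (congrArg Prod.fst h)
        simp [E, erase_of_notMem h, scale, erase_of_notMem h']
    exact DFunLike.congr_fun this (mk u)
  have hinj : Function.Injective scale := by
    refine map_injective ?_
    rintro ⟨x, i⟩ ⟨x', i'⟩ h
    simpa [hσ] using h
  rw [← hE, hinj (hscale_one.trans (_root_.map_one _).symm), _root_.map_one]

/-- **Freiheitssatz** (Magnus): if the minimal word `w` involves the generator `y`, then the
generators other than `y` freely generate a subgroup of the one-relator group defined by `w`. -/
theorem IsMinimalWord.freeOmitting {X : Type u} {w : List (X × Bool)} (hw : IsMinimalWord w)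
    {a : X × Bool} (ha : a ∈ w) : FreeOmitting w a.1 := by
  classical
  induction hn : w.length using Nat.strong_induction_on generalizing X with
  | _ n ih =>
    subst hn
    have ih' : ∀ r : List ((X × ℤ) × Bool), IsMinimalWord r → r.length < w.length →
        ∀ b ∈ r, FreeOmitting r b.1 := fun r hr hlt b hb => ih _ hlt hr hb rfl
    by_cases hσ : weight (Pi.single a.1 1) (mk w) = 1
    · exact freeOmitting_of_weight_eq_one hw ⟨a, ha, rfl⟩ hσ ih'
    by_cases hall : ∀ b ∈ w, b.1 = a.1
    · intro g hg hgN
      rw [← hg]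
      exact normalClosure_singleton_le_ker _ (erase_mk_eq_one hall) hgN
    · push Not at hall
      obtain ⟨b, hb, hne⟩ := hall
      exact freeOmitting_of_weight_ne_one hne.symm ⟨b, hb, rfl⟩
        (fun h => hσ (Multiplicative.toAdd.injective h)) (ofAdd_toAdd _).symm ih'

/-- Adjoining roots of a generator does not create new conjugacies: the pullback of the action of
`FreeGroup X` on itself along `twist t s` is induced up to `n = |s t|` copies. -/
theorem isConj_of_isConj_twist {X : Type*} {t : X} {s : X → ℤ} (hs : s t ≠ 0)
    {u v : FreeGroup X} (h : IsConj (twist t s u) (twist t s v)) : IsConj u v := by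
  classical
  obtain ⟨n, hn⟩ : ∃ n : ℕ, (s t).natAbs = n + 1 := Nat.exists_eq_succ_of_ne_zero (by simpa)
  let D : FreeGroup X →* Equiv.Perm (FreeGroup X × Fin (n + 1)) :=
    { toFun := fun g => Equiv.prodCongr (Equiv.mulLeft g) (Equiv.refl _)
      map_one' := by ext x <;> simp
      map_mul' := fun g h => by ext x <;> simp [mul_assoc] }
  let R : FreeGroup X → Equiv.Perm (FreeGroup X × Fin (n + 1)) :=
    fun g => Equiv.prodCongr (Equiv.mulRight g) (Equiv.refl _)
  let T : Equiv.Perm (FreeGroup X × Fin (n + 1)) :=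
    { toFun := fun x => (if x.2 = Fin.last n then of t * x.1 else x.1, x.2 + 1)
      invFun := fun x => (if x.2 = 0 then (of t)⁻¹ * x.1 else x.1, x.2 - 1)
      left_inv := fun x => by
        by_cases hx : x.2 = Fin.last n
        · have : (-1 : Fin (n + 1)) = Fin.last n := neg_eq_of_add_eq_zero_left (Fin.last_add_one n)
          refine Prod.ext ?_ ?_ <;> simp [hx, this]
        · have : x.2 + 1 ≠ 0 := fun h => hx (by
            rw [← Fin.last_add_one n] at h
            exact add_right_cancel h)
          simp [hx, this]
      right_inv := fun x => by
        by_cases hx : x.2 = 0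
        · have : (0 : Fin (n + 1)) - 1 = Fin.last n := by
            rw [sub_eq_iff_eq_add, Fin.last_add_one]
          refine Prod.ext ?_ ?_ <;> simp [hx, this]
        · have : x.2 - 1 ≠ Fin.last n := fun h => hx (by
            rw [sub_eq_iff_eq_add] at h
            rw [h, Fin.last_add_one])
          simp [hx, this] }
  have hTk : ∀ k (hk : k < n + 1) (g : FreeGroup X), (T ^ k) (g, 0) = (g, ⟨k, hk⟩) := by
    intro k hk g
    induction k with
    | zero => simp
    | succ k ih =>
      have hne : (⟨k, by lia⟩ : Fin (n + 1)) ≠ Fin.last n := by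
        intro h
        have := congrArg Fin.val h
        simp at this
        lia
      have hadd : (⟨k, by lia⟩ : Fin (n + 1)) + 1 = ⟨k + 1, hk⟩ := by
        apply Fin.ext
        rw [Fin.val_add_one]
        simp [hne]
      rw [pow_succ', Equiv.Perm.mul_apply, ih (by lia)]
      simp [T, hne, hadd]
  have hT0 : ∀ g, (T ^ (n + 1)) (g, 0) = (of t * g, 0) := by
    intro g
    have : (⟨n, by lia⟩ : Fin (n + 1)) = Fin.last n := rfl
    rw [pow_succ', Equiv.Perm.mul_apply, hTk n (by lia)]
    simp [T, this]
  have hTn : T ^ (n + 1) = D (of t) := by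
    apply Equiv.ext
    rintro ⟨g, k, hk⟩
    rw [← hTk k hk g, ← Equiv.Perm.mul_apply, (Commute.pow_pow_self T (n + 1) k).eq,
      Equiv.Perm.mul_apply, hT0, hTk k hk, hTk k hk]
    simp [D]
  obtain ⟨T', hT', hT'R⟩ : ∃ T' : Equiv.Perm (FreeGroup X × Fin (n + 1)),
      T' ^ s t = D (of t) ∧ ∀ g, Commute T' (R g) := by
    have hTR : ∀ g, Commute T (R g) := by
      intro g
      ext x
      · by_cases hx : x.2 = Fin.last n <;> simp [T, R, hx, mul_assoc]
      · simp [T, R]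
    rcases Int.natAbs_eq (s t) with h | h
    · refine ⟨T, ?_, hTR⟩
      rw [h, hn, zpow_natCast, hTn]
    · refine ⟨T⁻¹, ?_, fun g => (hTR g).inv_left⟩
      rw [h, hn, inv_zpow', neg_neg, zpow_natCast, hTn]
  have hDR : ∀ g h, Commute (D g) (R h) := by
    intro g h
    ext x <;> simp [D, R, mul_assoc]
  let L : FreeGroup X →* Equiv.Perm (FreeGroup X × Fin (n + 1)) :=
    lift fun x => if x = t then T' else D (of x) * T' ^ (-s x)
  have hLR : ∀ g h, Commute (L g) (R h) := by
    intro g h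
    induction g using FreeGroup.induction_on with
    | C1 => simp
    | of x =>
      by_cases hx : x = t
      · simpa [L, hx] using hT'R h
      · simpa [L, hx] using (hDR (of x) h).mul_left ((hT'R h).zpow_left (-s x))
    | inv_of x ih => simpa using ih.inv_left
    | mul x y hx hy => simpa using hx.mul_left hy
  have hLtwist : L.comp (twist t s) = D := by
    refine ext_hom _ _ fun x => ?_
    by_cases hx : x = t
    · subst hx
      simp [twist_of_self, L, hT']
    · simp [twist_of_ne _ hx, L, hx]
  obtain ⟨c, hc⟩ := isConj_iff.1 h
  have hc' : L c * D u = D v * L c := by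
    rw [← hLtwist, MonoidHom.comp_apply, MonoidHom.comp_apply, ← hc]
    simp
  have h₁ : (L c) (u, 0) = (((L c) (1, 0)).1 * u, ((L c) (1, 0)).2) := by
    have := DFunLike.congr_fun (hLR c u).eq (1, 0)
    simpa [R, Prod.map] using this
  have h₂ := congrArg Prod.fst (DFunLike.congr_fun hc' (1, 0))
  simp only [Equiv.Perm.mul_apply] at h₂
  have h₃ : D u (1, 0) = (u, 0) := by simp [D]
  rw [h₃, h₁] at h₂
  exact isConj_iff.2 ⟨((L c) (1, 0)).1, mul_inv_eq_of_eq_mul h₂⟩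

/-- The automorphism of `FreeGroup (X × ℤ)` sending `(x, i)` to `(x, i + k)`. -/
def shift {X : Type*} (k : ℤ) : FreeGroup (X × ℤ) →* FreeGroup (X × ℤ) :=
  map fun e => (e.1, e.2 + k)

theorem shift_of {X : Type*} (k : ℤ) (e : X × ℤ) :
    shift k (of e) = of (e.1, e.2 + k) := by
  simp [shift]

theorem shift_shift_neg {X : Type*} (k : ℤ) (g : FreeGroup (X × ℤ)) :
    shift k (shift (-k) g) = g := by
  have : (shift k).comp (shift (-k)) = MonoidHom.id (FreeGroup (X × ℤ)) := by
    ext e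
    simp [shift_of]
  exact DFunLike.congr_fun this g

theorem conjPow_shift {X : Type*} (t : X) (k : ℤ) (g : FreeGroup (X × ℤ)) :
    conjPow t (shift k g) = of t ^ k * conjPow t g * (of t ^ k)⁻¹ := by
  have : (conjPow t).comp (shift k) = (MulAut.conj (of t ^ k)).toMonoidHom.comp (conjPow t) := by
    ext ⟨x, i⟩
    simp only [MonoidHom.comp_apply, shift_of, conjPow_of, MulEquiv.toMonoidHom_eq_coe,
      MonoidHom.coe_coe, MulAut.conj_apply]
    group
  exact DFunLike.congr_fun this g

theorem map_mem_normalClosure {G H : Type*} [Group G] [Group H] (f : G →* H) {p q : G}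
    (h : p ∈ Subgroup.normalClosure {q}) : f p ∈ Subgroup.normalClosure {f q} := by
  have := Subgroup.map_normalClosure_le {q} f
  rw [Set.image_singleton] at this
  exact this (Subgroup.mem_map_of_mem f h)

theorem shift_mem_normalClosure {X : Type u} {t z : X} {r w : List ((X × ℤ) × Bool)}
    (hr : IsMinimalWord r) (hrt : ∀ b ∈ r, b.1.1 ≠ t) (hwt : ∀ b ∈ w, b.1.1 ≠ t) {m M : ℤ}
    (hm : ∃ b ∈ r, b.1 = (z, m)) (hM : ∃ b ∈ r, b.1 = (z, M))
    (hbd : ∀ b ∈ r, b.1.1 = z → m ≤ b.1.2 ∧ b.1.2 ≤ M) {k : ℤ}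
    (hk : ∀ b ∈ w, b.1.1 = z → m ≤ b.1.2 + k ∧ b.1.2 + k ≤ M)
    (h : conjPow t (mk w) ∈ Subgroup.normalClosure {conjPow t (mk r)}) :
    shift k (mk w) ∈ Subgroup.normalClosure {mk r} := by
  obtain ⟨bm, hbm, hbm'⟩ := hm
  obtain ⟨bM, hbM, hbM'⟩ := hM
  obtain ⟨G, _, j, Φ, deg, hj₁, hj, -, -, hΦ⟩ := exists_conjPow_extension t (mk r) z m M
    (hbm' ▸ hr.freeOmitting hbm) (hbM' ▸ hr.freeOmitting hbM)
  have hΦr : Φ (conjPow t (mk r)) = 1 :=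
    (map_mk_congr (Φ.comp (conjPow t)) j r fun b hb => hΦ _ _ (hrt b hb) (hbd b hb)).trans hj₁
  have hΦw : Φ (conjPow t (shift k (mk w))) = j (shift k (mk w)) :=
    map_mk_congr ((Φ.comp (conjPow t)).comp (shift k)) (j.comp (shift k)) w fun b hb => by
      simpa only [MonoidHom.comp_apply, shift_of] using hΦ _ _ (hwt b hb) (hk b hb)
  refine hj _ ?_
  have : Φ (conjPow t (mk w)) = 1 := normalClosure_singleton_le_ker Φ hΦr h
  rw [← hΦw, conjPow_shift]
  simp [this]

theorem mk_eq_one_of_shift_mem {X : Type u} {z : X} {r w : List ((X × ℤ) × Bool)}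
    (hr : IsMinimalWord r) {M k : ℤ} (hM : ∃ b ∈ r, b.1 = (z, M))
    (hwM : ∀ b ∈ w, b.1.1 = z → b.1.2 + k ≠ M)
    (h : shift k (mk w) ∈ Subgroup.normalClosure {mk r}) : mk w = 1 := by
  obtain ⟨b, hb, hbM⟩ := hM
  have h₁ : shift k (mk w) = 1 := by
    refine hr.freeOmitting hb _ ?_ h
    refine map_mk_congr ((erase {b.1}).comp (shift k)) (shift k) w fun c hc => ?_
    have : (c.1.1, c.1.2 + k) ∉ ({b.1} : Set (X × ℤ)) := by
      rw [hbM]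
      exact fun h => hwM c hc (congrArg Prod.fst h) (congrArg Prod.snd h)
    simp [shift_of, erase_of_notMem this]
  have h₂ := shift_shift_neg (-k) (mk w)
  rwa [neg_neg, h₁, _root_.map_one, eq_comm] at h₂

theorem exists_shift_normalClosure_eq {X : Type u} {t : X} {r w : List ((X × ℤ) × Bool)}
    (hr : IsMinimalWord r) (hw : IsMinimalWord w)
    (hrt : ∀ b ∈ r, b.1.1 ≠ t) (hwt : ∀ b ∈ w, b.1.1 ≠ t) (hr₁ : mk r ≠ 1) (hw₁ : mk w ≠ 1)
    (h : Subgroup.normalClosure {conjPow t (mk r)} =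
      Subgroup.normalClosure {conjPow t (mk w)}) :
    ∃ k, Subgroup.normalClosure {mk r} = Subgroup.normalClosure {shift k (mk w)} := by
  have hwr : conjPow t (mk w) ∈ Subgroup.normalClosure {conjPow t (mk r)} :=
    h ▸ Subgroup.subset_normalClosure (Set.mem_singleton _)
  have hrw : conjPow t (mk r) ∈ Subgroup.normalClosure {conjPow t (mk w)} :=
    h ▸ Subgroup.subset_normalClosure (Set.mem_singleton _)
  obtain ⟨b, hb⟩ : ∃ b, b ∈ r := List.exists_mem_of_ne_nil r (by rintro rfl; exact hr₁ rfl)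
  obtain ⟨m, M, hm, hM, hbd⟩ := exists_index_bounds r ⟨b, hb, rfl⟩
  have hex : ∃ c ∈ w, c.1.1 = b.1.1 := by
    by_contra! hall
    exact hw₁ (mk_eq_one_of_shift_mem hr hM (fun c hc h => absurd h (hall c hc))
      (shift_mem_normalClosure (k := 0) hr hrt hwt hm hM hbd
        (fun c hc h => absurd h (hall c hc)) hwr))
  obtain ⟨m', M', hm', hM', hbd'⟩ := exists_index_bounds w hex
  have hle : M - m ≤ M' - m' := by
    by_contra! hlt
    refine hw₁ (mk_eq_one_of_shift_mem (k := m - m') hr hM ?_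
      (shift_mem_normalClosure hr hrt hwt hm hM hbd ?_ hwr)) <;>
    · intro c hc hz
      have := hbd' c hc hz
      lia
  have hge : M' - m' ≤ M - m := by
    by_contra! hlt
    refine hr₁ (mk_eq_one_of_shift_mem (k := m' - m) hw hM' ?_
      (shift_mem_normalClosure hw hwt hrt hm' hM' hbd' ?_ hrw)) <;>
    · intro c hc hz
      have := hbd c hc hz
      lia
  have h₁ : shift (m - m') (mk w) ∈ Subgroup.normalClosure {mk r} :=
    shift_mem_normalClosure hr hrt hwt hm hM hbd
      (fun c hc hz => by have := hbd' c hc hz; lia) hwr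
  have h₂ : shift (-(m - m')) (mk r) ∈ Subgroup.normalClosure {mk w} :=
    shift_mem_normalClosure hw hwt hrt hm' hM' hbd'
      (fun c hc hz => by have := hbd c hc hz; lia) hrw
  refine ⟨m - m', le_antisymm ?_ ?_⟩
  · refine Subgroup.normalClosure_le_normal (Set.singleton_subset_iff.2 ?_)
    have := map_mem_normalClosure (shift (m - m')) h₂
    rwa [shift_shift_neg] at this
  · exact Subgroup.normalClosure_le_normal (Set.singleton_subset_iff.2 h₁)

theorem isConj_inv_inv {G : Type*} [Group G] {a b : G} (h : IsConj a b) : IsConj a⁻¹ b⁻¹ := by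
  obtain ⟨c, rfl⟩ := isConj_iff.1 h
  exact isConj_iff.2 ⟨c, by group⟩

theorem isConj_or_of_normalClosure_eq_of_weight {X : Type u} {r w : List (X × Bool)}
    {t : X} {s : X → ℤ} (hst : s t ≠ 0) (hr : ∃ a ∈ r, a.1 = t) (hw : ∃ a ∈ w, a.1 = t)
    (hs : weight s (mk r) = 1) (hr₁ : mk r ≠ 1)
    (h : Subgroup.normalClosure {mk r} = Subgroup.normalClosure {mk w})
    (ih : ∀ r' : List ((X × ℤ) × Bool), IsMinimalWord r' → r'.length < r.length →
      ∀ q, Subgroup.normalClosure {mk r'} = Subgroup.normalClosure {q} →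
        IsConj (mk r') q ∨ IsConj (mk r')⁻¹ q) :
    IsConj (mk r) (mk w) ∨ IsConj (mk r)⁻¹ (mk w) := by
  have hrw : mk r ∈ Subgroup.normalClosure {mk w} :=
    h ▸ Subgroup.subset_normalClosure (Set.mem_singleton _)
  have hwr : mk w ∈ Subgroup.normalClosure {mk r} :=
    h ▸ Subgroup.subset_normalClosure (Set.mem_singleton _)
  have hw₁ : mk w ≠ 1 := by
    intro hw₁
    exact hr₁ (normalClosure_singleton_le_ker (MonoidHom.id _) hw₁ hrw)
  obtain ⟨r', hr', hlt, hrt, hrc⟩ := exists_minimal_conjPow_word t s r hr hs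
  obtain ⟨w', hw', -, hwt, hwc⟩ := exists_minimal_conjPow_word t s w hw
    (normalClosure_singleton_le_ker _ hs hwr)
  have hne : ∀ {v : List (X × Bool)} {v' : List ((X × ℤ) × Bool)},
      IsConj (twist t s (mk v)) (conjPow t (mk v')) → mk v ≠ 1 → mk v' ≠ 1 := by
    intro v v' hc hv hv'
    rw [hv', _root_.map_one, ← _root_.map_one (twist t s)] at hc
    exact hv (isConj_one_left.1 (isConj_of_isConj_twist hst hc))
  obtain ⟨k, hk⟩ := exists_shift_normalClosure_eq hr' hw' hrt hwt (hne hrc hr₁) (hne hwc hw₁) (by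
    rw [← normalClosure_singleton_eq_of_isConj hrc, ← normalClosure_singleton_eq_of_isConj hwc]
    exact le_antisymm
      (Subgroup.normalClosure_le_normal
        (Set.singleton_subset_iff.2 (map_mem_normalClosure _ hrw)))
      (Subgroup.normalClosure_le_normal
        (Set.singleton_subset_iff.2 (map_mem_normalClosure _ hwr))))
  have hshift : IsConj (conjPow t (shift k (mk w'))) (twist t s (mk w)) := by
    rw [conjPow_shift]
    exact ((hwc.trans (isConj_iff.2 ⟨_, rfl⟩ : IsConj _ _))).symm
  refine (ih r' hr' hlt _ hk).imp (fun hc => ?_) fun hc => ?_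
  · exact isConj_of_isConj_twist hst
      ((hrc.trans ((conjPow t).map_isConj hc)).trans hshift)
  · apply isConj_of_isConj_twist hst
    have := (conjPow t).map_isConj hc
    rw [_root_.map_inv] at this ⊢
    exact ((isConj_inv_inv hrc).trans this).trans hshift

theorem isConj_or_of_normalClosure_eq_of_single {X : Type*} {r w : List (X × Bool)} {x : X}
    (hr : ∀ a ∈ r, a.1 = x) (hw : ∀ a ∈ w, a.1 = x)
    (h : Subgroup.normalClosure {mk r} = Subgroup.normalClosure {mk w}) :
    IsConj (mk r) (mk w) ∨ IsConj (mk r)⁻¹ (mk w) := by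
  let s : FreeGroup X →* Multiplicative ℤ := weight fun _ => 1
  have hpow : ∀ v : List (X × Bool), (∀ a ∈ v, a.1 = x) → mk v = of x ^ (s (mk v)).toAdd :=
    fun v hv => map_mk_congr (MonoidHom.id _) ((zpowersHom _ (of x)).comp s) v fun a ha => by
      simp [s, weight_of, hv a ha]
  have hdvd : ∀ u v : FreeGroup X, Subgroup.normalClosure {u} = Subgroup.normalClosure {v} →
      (s u).toAdd ∣ (s v).toAdd := by
    intro u v huv
    have hle : Subgroup.normalClosure {u} ≤ (Subgroup.zpowers (s u)).comap s :=
      Subgroup.normalClosure_le_normal (by simp)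
    obtain ⟨n, hn⟩ := hle (huv ▸ Subgroup.subset_normalClosure (Set.mem_singleton v))
    refine ⟨n, ?_⟩
    simpa [mul_comm] using (congrArg Multiplicative.toAdd hn).symm
  have habs := Nat.dvd_antisymm (Int.natAbs_dvd_natAbs.2 (hdvd _ _ h))
    (Int.natAbs_dvd_natAbs.2 (hdvd _ _ h.symm))
  rw [hpow r hr, hpow w hw]
  rcases Int.natAbs_eq_natAbs_iff.1 habs with h₁ | h₁
  · exact Or.inl (h₁ ▸ IsConj.refl _)
  · right
    rw [h₁, zpow_neg, inv_inv]

theorem exists_weight_eq_one {X : Type*} {y t : X} (hyt : y ≠ t) (g : FreeGroup X) :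
    ∃ s : X → ℤ, weight s g = 1 ∧ (s y ≠ 0 ∨ s t ≠ 0) := by
  classical
  by_cases h : (weight (Pi.single y 1) g).toAdd = 0
  · exact ⟨Pi.single y 1, Multiplicative.toAdd.injective h, by simp⟩
  · exact ⟨_, weight_single_sub_single_self hyt g, Or.inr (by simpa [hyt.symm] using h)⟩

/-- **Conjugacy theorem** (Magnus): if the minimal word `r` and `q` have the same normal closure,
then `q` is conjugate to `r` or to its inverse. -/
theorem IsMinimalWord.isConj_or_of_normalClosure_eq {X : Type u} {r : List (X × Bool)}
    (hr : IsMinimalWord r) {q : FreeGroup X}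
    (h : Subgroup.normalClosure {mk r} = Subgroup.normalClosure {q}) :
    IsConj (mk r) q ∨ IsConj (mk r)⁻¹ q := by
  induction hn : r.length using Nat.strong_induction_on generalizing X with
  | _ n ih =>
    subst hn
    classical
    obtain ⟨w, hqw, hw, -⟩ := exists_isMinimalWord q.toWord
    rw [mk_toWord] at hqw
    rw [normalClosure_singleton_eq_of_isConj hqw] at h
    suffices IsConj (mk r) (mk w) ∨ IsConj (mk r)⁻¹ (mk w) from
      this.imp (fun h => h.trans hqw.symm) fun h => h.trans hqw.symm
    have hletters : ∀ {u v : List (X × Bool)}, IsMinimalWord u →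
        Subgroup.normalClosure {mk u} = Subgroup.normalClosure {mk v} →
        ∀ a ∈ u, ∃ b ∈ v, b.1 = a.1 := by
      intro u v hu huv a ha
      by_contra! hall
      have hv : mk v = 1 := hu.freeOmitting ha _ (erase_mk_eq_self hall)
        (huv ▸ Subgroup.subset_normalClosure (Set.mem_singleton _))
      have hu₁ : mk u = 1 := normalClosure_singleton_le_ker (MonoidHom.id _) hv
        (huv ▸ Subgroup.subset_normalClosure (Set.mem_singleton _))
      have := hu [] (by rw [hu₁]; exact IsConj.refl _)
      simp_all
    have hmk : ∀ a ∈ r, mk r ≠ 1 := by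
      intro a ha hr₁
      have := hr [] (by rw [hr₁]; exact IsConj.refl _)
      simp_all
    by_cases hall : ∀ a ∈ r, ∀ b ∈ r, b.1 = a.1
    · rcases r.eq_nil_or_concat' with rfl | ⟨r₀, a, rfl⟩
      · left
        have : mk w = 1 := normalClosure_singleton_le_ker (MonoidHom.id _) one_eq_mk.symm
          (h ▸ Subgroup.subset_normalClosure (Set.mem_singleton _))
        rw [this, ← one_eq_mk]
      · have ha : a ∈ r₀ ++ [a] := by simp
        refine isConj_or_of_normalClosure_eq_of_single (hall a ha) (fun b hb => ?_) h
        obtain ⟨c, hc, hcb⟩ := hletters hw h.symm b hb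
        rw [← hcb, hall a ha c hc]
    · push Not at hall
      obtain ⟨a, ha, b, hb, hab⟩ := hall
      have key : ∀ c ∈ r, ∀ s : X → ℤ, s c.1 ≠ 0 → weight s (mk r) = 1 →
          IsConj (mk r) (mk w) ∨ IsConj (mk r)⁻¹ (mk w) := fun c hc s hsc hs =>
        isConj_or_of_normalClosure_eq_of_weight hsc ⟨c, hc, rfl⟩ (hletters hr h c hc) hs
          (hmk c hc) h fun r' hr' hlt q' hq' => ih _ hlt hr' hq' rfl
      obtain ⟨s, hs, h₁ | h₁⟩ := exists_weight_eq_one hab (mk r)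
      · exact key b hb s h₁ hs
      · exact key a ha s h₁ hs

end FreeGroup

/-- (Magnus) If the normal closure of `q` in a free group contains a primitive
element `p` and coincides with the normal closure of `p`, then `q` is conjugate
to `p` or to `p⁻¹`. -/
theorem magnus_conjugacy (α : Type*) (p q : FreeGroup α)
    (hp : p.IsPrimitive)
    (hmem : p ∈ Subgroup.normalClosure ({q} : Set (FreeGroup α)))
    (hcl : Subgroup.normalClosure ({q} : Set (FreeGroup α))
      = Subgroup.normalClosure ({p} : Set (FreeGroup α))) :
    IsConj p q ∨ IsConj p⁻¹ q := by
  classical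
  obtain ⟨r, hpr, hr, -⟩ := FreeGroup.exists_isMinimalWord p.toWord
  rw [FreeGroup.mk_toWord] at hpr
  rw [FreeGroup.normalClosure_singleton_eq_of_isConj hpr] at hcl
  exact (hr.isConj_or_of_normalClosure_eq hcl.symm).imp hpr.trans
    (FreeGroup.isConj_inv_inv hpr).trans
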